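/- A preradical σ on R-Mod is left exact and cohereditary if and only if σ(M) = σ(R)M for every R-module M and x ∈ σ(R)x for every x ∈ σ(R). -/

import Mathlib

/-! Basic framework: bundled left `R`-modules (in the same universe as `R`),
preradicals on `R`-Mod, and the notions from the paper
"On σ-classes of modules with applications". -/

universe u

/-- A bundled left `R`-module whose underlying type lives in the same universe as `R`. -/
structure RMod (R : Type u) [Ring R] : Type (u + 1) where
  carrier : Type u
  [isAddCommGroup : AddCommGroup carrier]
  [isModule : Module R carrier]

attribute [instance] RMod.isAddCommGroup RMod.isModule

instance (R : Type u) [Ring R] : CoeSort (RMod R) (Type u) :=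
  ⟨RMod.carrier⟩

/-- Bundle a module into `RMod R`. -/
@[reducible] def RMod.of (R : Type u) [Ring R] (M : Type u) [AddCommGroup M] [Module R M] :
    RMod R := ⟨M⟩

/-- A preradical on `R`-Mod: a subfunctor of the identity functor, i.e. an assignment
`M ↦ σ(M) ≤ M` such that `f(σ(M)) ≤ σ(N)` for every `R`-linear map `f : M → N`. -/
structure Preradical (R : Type u) [Ring R] : Type (u + 1) where
  app : ∀ M : RMod R, Submodule R (M : Type u)
  map_le : ∀ {M N : RMod R} (f : (M : Type u) →ₗ[R] (N : Type u)),
    (app M).map f ≤ app N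

namespace Preradical

variable {R : Type u} [Ring R]

/-- `σ` evaluated on an unbundled module. -/
@[reducible] def ap (σ : Preradical R) (M : Type u) [AddCommGroup M] [Module R M] :
    Submodule R M :=
  σ.app (RMod.of R M)

/-- `σ` is cohereditary: `f(σ(M)) = σ(N)` for every surjective `f : M → N`. -/
def Cohereditary (σ : Preradical R) : Prop :=
  ∀ (M N : RMod R) (f : (M : Type u) →ₗ[R] (N : Type u)), Function.Surjective f →
    (σ.app M).map f = σ.app N

/-- `σ` is a radical: `σ(M/σ(M)) = 0` for every `M`. -/
def IsRadical (σ : Preradical R) : Prop :=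
  ∀ M : RMod R, σ.ap ((M : Type u) ⧸ σ.app M) = ⊥

/-- The torsion-free class `F_σ = {M : σ(M) = 0}` is closed under quotients. -/
def TorsionFreeClosedUnderQuotients (σ : Preradical R) : Prop :=
  ∀ (M N : RMod R) (f : (M : Type u) →ₗ[R] (N : Type u)), Function.Surjective f →
    σ.app M = ⊥ → σ.app N = ⊥

/-- The submodule `σ(R)M` of `M`, generated by `{a • m : a ∈ σ(R), m ∈ M}`. -/
def idealSMulTop (σ : Preradical R) (M : RMod R) : Submodule R (M : Type u) :=
  Submodule.span R {x : (M : Type u) | ∃ a ∈ σ.ap R, ∃ m : (M : Type u), x = a • m}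

/-- `σ` is left exact: `σ(A) = A ∩ σ(B)` whenever `A` is a submodule of `B`. -/
def LeftExact (σ : Preradical R) : Prop :=
  ∀ (B : RMod R) (A : Submodule R (B : Type u)),
    (σ.ap ↥A).map A.subtype = A ⊓ σ.app B

/-- `σ` centrally splits: there is a central idempotent `e ∈ R` with `σ(M) = eM`
for every module `M`. -/
def CentrallySplits (σ : Preradical R) : Prop :=
  ∃ e : R, e ∈ Set.center R ∧ e * e = e ∧
    ∀ M : RMod R, (σ.app M : Set (M : Type u)) = Set.range fun m : (M : Type u) => e • m

/-- `σ` is stable: `σ(E)` is a direct summand of `E` for every injective module `E`. -/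
def Stable (σ : Preradical R) : Prop :=
  ∀ E : RMod R, Module.Injective R (E : Type u) →
    ∃ K : Submodule R (E : Type u), IsCompl (σ.app E) K

/-- `σ` is costable: `σ(P)` is a direct summand of `P` for every projective module `P`. -/
def Costable (σ : Preradical R) : Prop :=
  ∀ P : RMod R, Module.Projective R (P : Type u) →
    ∃ K : Submodule R (P : Type u), IsCompl (σ.app P) K

/-- The condition `(σ-HH)`: for all modules `M`, `N` with `σ(M) ≠ 0` and `σ(N) ≠ 0`,
`Hom(σ(N), M) ≠ 0` iff `Hom(M, σ(N)) ≠ 0`. -/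
def HH (σ : Preradical R) : Prop :=
  ∀ M N : RMod R, σ.app M ≠ ⊥ → σ.app N ≠ ⊥ →
    ((∃ f : ↥(σ.app N) →ₗ[R] (M : Type u), f ≠ 0) ↔
      (∃ f : (M : Type u) →ₗ[R] ↥(σ.app N), f ≠ 0))

/-- `R` is σ-(R-Mod)-retractable: for every `M` and every `N ≤ M` with `σ(N) ≠ 0`,
`Hom(M, σ(N)) ≠ 0`. -/
def Retractable (σ : Preradical R) : Prop :=
  ∀ (M : RMod R) (N : Submodule R (M : Type u)), σ.ap ↥N ≠ ⊥ →
    ∃ f : (M : Type u) →ₗ[R] ↥(σ.ap ↥N), f ≠ 0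

end Preradical

/-- `M` is parainjective: whenever `M` embeds in `N`, `M` is a quotient of `N`. -/
def Parainjective (R : Type u) [Ring R] (M : Type u) [AddCommGroup M] [Module R M] : Prop :=
  ∀ N : RMod R, (∃ f : M →ₗ[R] (N : Type u), Function.Injective f) →
    ∃ g : (N : Type u) →ₗ[R] M, Function.Surjective g

/-- `M` is paraprojective: whenever `M` is a quotient of `N`, `M` embeds in `N`. -/
def Paraprojective (R : Type u) [Ring R] (M : Type u) [AddCommGroup M] [Module R M] : Prop :=
  ∀ N : RMod R, (∃ f : (N : Type u) →ₗ[R] M, Function.Surjective f) →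
    ∃ g : M →ₗ[R] (N : Type u), Function.Injective g

namespace Preradical

variable {R : Type u} [Ring R]

/-- `R` is a left σ-max ring: every nonzero quotient `L` of any module `M` with
`σ(L) ≠ 0` has a σ-torsion simple quotient. -/
def SigmaMax (σ : Preradical R) : Prop :=
  ∀ (M L : RMod R) (f : (M : Type u) →ₗ[R] (L : Type u)), Function.Surjective f →
    Nontrivial (L : Type u) → σ.app L ≠ ⊥ →
    ∃ K : Submodule R (L : Type u),
      IsSimpleModule R ((L : Type u) ⧸ K) ∧ σ.ap ((L : Type u) ⧸ K) = ⊤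

/-- `R` is left σ-semiartinian: every nonzero submodule `N` of any module `M` with
`σ(N) ≠ 0` contains a σ-torsion simple submodule. -/
def SigmaSemiartinian (σ : Preradical R) : Prop :=
  ∀ (M : RMod R) (N : Submodule R (M : Type u)), N ≠ ⊥ → σ.ap ↥N ≠ ⊥ →
    ∃ S : Submodule R (M : Type u), S ≤ N ∧ IsSimpleModule R ↥S ∧ σ.ap ↥S = ⊤

/-- `R` is a σ-(BKN)-ring: `Hom(σ(N), σ(M)) ≠ 0` for all `M`, `N` with
`σ(M) ≠ 0 ≠ σ(N)`. -/
def BKN (σ : Preradical R) : Prop :=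
  ∀ M N : RMod R, σ.app M ≠ ⊥ → σ.app N ≠ ⊥ →
    ∃ f : ↥(σ.app N) →ₗ[R] ↥(σ.app M), f ≠ 0

/-- `R` is a left σ-local ring: up to isomorphism there is exactly one σ-torsion
simple module. -/
def SigmaLocal (σ : Preradical R) : Prop :=
  (∃ S : RMod R, IsSimpleModule R (S : Type u) ∧ σ.app S = ⊤) ∧
  ∀ S T : RMod R, IsSimpleModule R (S : Type u) → σ.app S = ⊤ →
    IsSimpleModule R (T : Type u) → σ.app T = ⊤ →
    Nonempty ((S : Type u) ≃ₗ[R] (T : Type u))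

end Preradical

/-- A class of modules is closed under isomorphism. -/
def RespectsIso (R : Type u) [Ring R] (C : RMod R → Prop) : Prop :=
  ∀ M N : RMod R, Nonempty ((M : Type u) ≃ₗ[R] (N : Type u)) → C M → C N

namespace Preradical

variable {R : Type u} [Ring R]

/-- `C` is a σ-cohereditary class: `F_σ ⊆ C`, and `σ(L) ∈ C` for every `M ∈ C` and
every quotient `L` of `M`. -/
def SigmaCohereditaryClass (σ : Preradical R) (C : RMod R → Prop) : Prop :=
  (∀ M : RMod R, σ.app M = ⊥ → C M) ∧
  ∀ (M L : RMod R) (f : (M : Type u) →ₗ[R] (L : Type u)), Function.Surjective f → C M →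
    C (RMod.of R ↥(σ.app L))

/-- `C` is a σ-hereditary class: `F_σ ⊆ C`, and `σ(N) ∈ C` for every `M ∈ C` and
every submodule `N ≤ M`. -/
def SigmaHereditaryClass (σ : Preradical R) (C : RMod R → Prop) : Prop :=
  (∀ M : RMod R, σ.app M = ⊥ → C M) ∧
  ∀ (M : RMod R) (N : Submodule R (M : Type u)), C M → C (RMod.of R ↥(σ.ap ↥N))

/-- `C` is closed under arbitrary direct sums. -/
def ClassClosedUnderDirectSums (C : RMod R → Prop) : Prop :=
  ∀ (ι : Type u) (M : ι → RMod R), (∀ i, C (M i)) →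
    C (RMod.of R (DirectSum ι fun i => ((M i) : Type u)))

/-- `C` is closed under extensions. -/
def ClassClosedUnderExtensions (C : RMod R → Prop) : Prop :=
  ∀ (M : RMod R) (A : Submodule R (M : Type u)),
    C (RMod.of R ↥A) → C (RMod.of R ((M : Type u) ⧸ A)) → C M

/-- `C` is a σ-torsion class: a σ-cohereditary class closed under arbitrary direct
sums and under extensions. -/
def SigmaTorsionClass (σ : Preradical R) (C : RMod R → Prop) : Prop :=
  σ.SigmaCohereditaryClass C ∧ ClassClosedUnderDirectSums C ∧ ClassClosedUnderExtensions C

/-- `C` is a hereditary σ-torsion class. -/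
def HereditarySigmaTorsionClass (σ : Preradical R) (C : RMod R → Prop) : Prop :=
  σ.SigmaTorsionClass C ∧ σ.SigmaHereditaryClass C

/-- `C` satisfies the condition `(σ-CN)`. -/
def SigmaCN (σ : Preradical R) (C : RMod R → Prop) : Prop :=
  ∀ M : RMod R,
    (∀ (L : RMod R) (f : (M : Type u) →ₗ[R] (L : Type u)), Function.Surjective f →
      σ.app L ≠ ⊥ →
      ∃ C₀ N : RMod R, C C₀ ∧ σ.app N ≠ ⊥ ∧
        (∃ g : (L : Type u) →ₗ[R] (N : Type u), Function.Surjective g) ∧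
        (∃ h : (C₀ : Type u) →ₗ[R] (N : Type u), Function.Surjective h)) →
    C M

/-- `C` satisfies the condition `(σ-N)`. -/
def SigmaN (σ : Preradical R) (C : RMod R → Prop) : Prop :=
  ∀ M : RMod R,
    (∀ L : Submodule R (M : Type u), σ.ap ↥L ≠ ⊥ →
      ∃ C₀ N : RMod R, C C₀ ∧ σ.app N ≠ ⊥ ∧
        (∃ g : (N : Type u) →ₗ[R] ↥L, Function.Injective g) ∧
        (∃ h : (N : Type u) →ₗ[R] (C₀ : Type u), Function.Injective h)) →
    C M

/-- The pseudocomplement `D^{⊥/σ}` of a class `D`: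
`{M : every quotient L of M with σ(L) ≠ 0 satisfies σ(L) ∉ D} ∪ F_σ`. -/
def Perp (σ : Preradical R) (D : RMod R → Prop) : RMod R → Prop := fun M =>
  (∀ (L : RMod R) (f : (M : Type u) →ₗ[R] (L : Type u)), Function.Surjective f →
    σ.app L ≠ ⊥ → ¬ D (RMod.of R ↥(σ.app L))) ∨ σ.app M = ⊥

/-- `C` is a σ-natural class: there is a σ-hereditary class `A` with
`C = {M : for every N ≤ M with σ(N) ∈ A one has σ(N) = 0}`. -/
def SigmaNaturalClass (σ : Preradical R) (C : RMod R → Prop) : Prop :=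
  ∃ A : RMod R → Prop, RespectsIso R A ∧ σ.SigmaHereditaryClass A ∧
    ∀ M : RMod R, C M ↔
      ∀ N : Submodule R (M : Type u), A (RMod.of R ↥(σ.ap ↥N)) → σ.ap ↥N = ⊥

end Preradical

/-- `σ` is left exact and cohereditary iff `σ(M) = σ(R)M` for every `M`
and `x ∈ σ(R)x` for every `x ∈ σ(R)`. -/
theorem leftExact_and_cohereditary_iff {R : Type u} [Ring R] (σ : Preradical R) :
    (σ.LeftExact ∧ σ.Cohereditary) ↔
      ((∀ M : RMod R, σ.app M = σ.idealSMulTop M) ∧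
        ∀ x ∈ σ.ap R, ∃ a ∈ σ.ap R, x = a • x) := by
  constructor
  · rintro ⟨hl, hc⟩
    refine ⟨fun M => le_antisymm ?_ ?_, fun x hx => ?_⟩
    · have hsurj : Function.Surjective
          (Finsupp.linearCombination R (id : M.carrier → M.carrier)) := by
        intro m
        exact ⟨Finsupp.single m 1, by rw [Finsupp.linearCombination_single, one_smul, id]⟩
      rw [← hc (RMod.of R ((M : Type u) →₀ R)) M (Finsupp.linearCombination R id) hsurj]
      rintro _ ⟨y, hy, rfl⟩
      rw [Finsupp.linearCombination_apply, Finsupp.sum]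
      refine Submodule.sum_mem _ fun i _ => Submodule.subset_span ⟨y i, ?_, i, rfl⟩
      exact σ.map_le (M := RMod.of R ((M : Type u) →₀ R)) (N := RMod.of R R)
        (Finsupp.lapply i) ⟨y, hy, rfl⟩
    · refine Submodule.span_le.2 ?_
      rintro _ ⟨a, ha, m, rfl⟩
      exact σ.map_le (M := RMod.of R R) (N := M) (LinearMap.toSpanSingleton R _ m) ⟨a, ha, rfl⟩
    · have h1 := hl (RMod.of R R) (Submodule.span R {x})
      have hxA : x ∈ Submodule.span R {x} := Submodule.mem_span_singleton_self x
      have h2 : x ∈ (σ.ap ↥(Submodule.span R {x})).map (Submodule.span R {x}).subtype := by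
        rw [h1]; exact ⟨hxA, hx⟩
      obtain ⟨y, hy, hyx⟩ := h2
      have hsurj : Function.Surjective
          (LinearMap.toSpanSingleton R ↥(Submodule.span R {x}) ⟨x, hxA⟩) := by
        rintro ⟨z, hz⟩
        obtain ⟨r, rfl⟩ := Submodule.mem_span_singleton.1 hz
        exact ⟨r, rfl⟩
      have h3 := hc (RMod.of R R) (RMod.of R ↥(Submodule.span R {x})) _ hsurj
      have hy' := hy
      rw [SetLike.mem_coe, Preradical.ap, ← h3] at hy'
      obtain ⟨a, ha, hay⟩ := hy'
      refine ⟨a, ha, ?_⟩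
      rw [← hay] at hyx
      exact hyx.symm
  · rintro ⟨hM, hx⟩
    have hgen : ∀ (M : RMod R) (a : R) (m : (M : Type u)), a ∈ σ.ap R → a • m ∈ σ.app M := by
      intro M a m ha
      exact σ.map_le (M := RMod.of R R) (N := M) (LinearMap.toSpanSingleton R _ m) ⟨a, ha, rfl⟩
    refine ⟨fun B A => le_antisymm ?_ ?_, fun M N f hf => le_antisymm (σ.map_le f) ?_⟩
    · refine le_inf ?_ (σ.map_le (M := RMod.of R ↥A) (N := B) A.subtype)
      rintro _ ⟨y, _, rfl⟩
      exact y.2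
    · rintro x ⟨hxA, hxB⟩
      have key : ∀ y ∈ σ.idealSMulTop B, ∀ r : R, ∃ a ∈ σ.ap R, a • (r • y) = r • y := by
        intro y hy
        unfold Preradical.idealSMulTop at hy
        induction hy using Submodule.span_induction with
        | mem y h =>
          obtain ⟨a, ha, m, rfl⟩ := h
          intro r
          obtain ⟨b, hb, hb'⟩ := hx (r • a) (Submodule.smul_mem _ r ha)
          refine ⟨b, hb, ?_⟩
          rw [smul_smul, smul_smul]
          simp only [smul_eq_mul] at hb'
          rw [mul_assoc, ← hb', mul_smul]
        | zero => exact fun r => ⟨0, Submodule.zero_mem _, by simp⟩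
        | add y z _ _ ihy ihz =>
          intro r
          obtain ⟨a, ha, hay⟩ := ihy r
          obtain ⟨b, hb, hbz⟩ := ihz ((1 - a) * r)
          refine ⟨b + a - b * a, Submodule.sub_mem _ (Submodule.add_mem _ hb ha)
            (Submodule.smul_mem _ b ha), ?_⟩
          rw [mul_smul, sub_smul, one_smul, smul_sub] at hbz
          rw [smul_add, smul_add, sub_smul, sub_smul, add_smul, add_smul, mul_smul, mul_smul, hay]
          have : b • r • z = r • z - a • r • z + b • a • r • z := by
            rw [← hbz]; abel
          rw [this]; abel
        | smul c y _ ih =>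
          intro r
          obtain ⟨a, ha, h⟩ := ih (r * c)
          exact ⟨a, ha, by rw [smul_smul r c y]; exact h⟩
      obtain ⟨a, ha, h⟩ := key x (by rw [← hM]; exact hxB) 1
      rw [one_smul] at h
      exact ⟨a • ⟨x, hxA⟩, hgen (RMod.of R ↥A) a ⟨x, hxA⟩ ha, h⟩
    · rw [hM N]
      refine Submodule.span_le.2 ?_
      rintro _ ⟨a, ha, n, rfl⟩
      obtain ⟨m, rfl⟩ := hf n
      exact ⟨a • m, hgen M a m ha, map_smul f a m⟩
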